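/- arXiv:2604.19590 — 3 statements merged into one kernel-verified Lean document; each statement's English description precedes it below -/
import Mathlib

section
/- If 0 < θ < 1, then W′(0) = 0 and u = 0 is a strict local maximum of W; there exists a unique u_θ ∈ (0, 1) with W′(u_θ) = 0; W is strictly decreasing on [0, u_θ] and strictly increasing on [u_θ, 1]; consequently the minimum of W over [−1, 1] is attained exactly at the two points u_θ and −u_θ, and W(u_θ) = W(−u_θ). -/
/-- The Flory–Huggins potential `W(u) = (θ/2)((1−u)ln(1−u) + (1+u)ln(1+u)) + (1/2)(1−u²)`.
Lean's convention `Real.log 0 = 0` realizes the convention `0 · ln 0 = 0`. -/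
noncomputable def FH (θ u : ℝ) : ℝ :=
  θ / 2 * ((1 - u) * Real.log (1 - u) + (1 + u) * Real.log (1 + u)) + 1 / 2 * (1 - u ^ 2)

theorem FH_neg (θ u : ℝ) : FH θ (-u) = FH θ u := by
  unfold FH
  rw [sub_neg_eq_add, ← sub_eq_add_neg]
  ring

theorem FH_abs (θ u : ℝ) : FH θ |u| = FH θ u := by
  rcases abs_choice u with h | h <;> rw [h]
  exact FH_neg θ u

theorem continuous_FH (θ : ℝ) : Continuous (FH θ) := by
  have h1 : Continuous fun u : ℝ => (1 - u) * Real.log (1 - u) :=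
    Real.continuous_mul_log.comp (continuous_const.sub continuous_id)
  have h2 : Continuous fun u : ℝ => (1 + u) * Real.log (1 + u) :=
    Real.continuous_mul_log.comp (continuous_const.add continuous_id)
  exact (continuous_const.mul (h1.add h2)).add (by fun_prop)

/-- The derivative of `FH θ` on `(-1, 1)`. -/
noncomputable def FHDeriv (θ u : ℝ) : ℝ :=
  θ / 2 * Real.log ((1 + u) / (1 - u)) - u

theorem hasDerivAt_FH (θ : ℝ) {u : ℝ} (hu : u ∈ Set.Ioo (-1 : ℝ) 1) :
    HasDerivAt (FH θ) (FHDeriv θ u) u := by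
  obtain ⟨hl, hr⟩ := hu
  have hm : (1 - u) ≠ 0 := by linarith
  have hp : (1 + u) ≠ 0 := by linarith
  have h1 := (Real.hasDerivAt_mul_log hm).comp u ((hasDerivAt_id u).const_sub 1)
  have h2 := (Real.hasDerivAt_mul_log hp).comp u ((hasDerivAt_id u).const_add 1)
  have h3 := (((hasDerivAt_id u).pow 2).const_sub 1).const_mul (1 / 2 : ℝ)
  have h := ((h1.add h2).const_mul (θ / 2)).add h3
  refine h.congr_deriv ?_
  rw [FHDeriv, Real.log_div hp hm]
  simp only [id]
  ring

theorem hasDerivAt_FHDeriv (θ : ℝ) {u : ℝ} (hu : u ∈ Set.Ioo (-1 : ℝ) 1) :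
    HasDerivAt (FHDeriv θ) (θ / (1 - u ^ 2) - 1) u := by
  obtain ⟨hl, hr⟩ := hu
  have hm : (1 - u) ≠ 0 := by linarith
  have hp : (1 + u) ≠ 0 := by linarith
  have hs : 1 - u ^ 2 ≠ 0 := by
    rw [show 1 - u ^ 2 = (1 - u) * (1 + u) by ring]
    exact mul_ne_zero hm hp
  have h1 := ((hasDerivAt_id u).const_add 1).div ((hasDerivAt_id u).const_sub 1) hm
  have h := ((h1.log (div_ne_zero hp hm)).const_mul (θ / 2)).sub (hasDerivAt_id u)
  refine h.congr_deriv ?_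
  simp only [id, Pi.div_apply]
  field_simp
  ring

theorem FHDeriv_zero (θ : ℝ) : FHDeriv θ 0 = 0 := by simp [FHDeriv]

theorem exists_FHDeriv_pos {θ : ℝ} (hθ : 0 < θ) : ∃ t ∈ Set.Ioo (0 : ℝ) 1, 0 < FHDeriv θ t := by
  have he : 1 < Real.exp (2 / θ) := Real.one_lt_exp_iff.mpr (by positivity)
  set e := Real.exp (2 / θ) with h_e
  have ht1 : (e - 1) / (e + 1) < 1 := by rw [div_lt_one (by linarith)]; linarith
  refine ⟨(e - 1) / (e + 1), ⟨div_pos (by linarith) (by linarith), ht1⟩, ?_⟩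
  have hq : (1 + (e - 1) / (e + 1)) / (1 - (e - 1) / (e + 1)) = e := by
    have : e + 1 ≠ 0 := by linarith
    rw [div_eq_iff (by linarith)]
    field_simp
    ring
  rw [FHDeriv, hq, h_e, Real.log_exp, ← h_e, show θ / 2 * (2 / θ) = 1 by field_simp]
  linarith

theorem exists_FHDeriv_sign_change {θ : ℝ} (hθ0 : 0 < θ) (hθ1 : θ < 1) :
    ∃ a ∈ Set.Ioo (0 : ℝ) 1, FHDeriv θ a = 0 ∧ (∀ u ∈ Set.Ioo 0 a, FHDeriv θ u < 0) ∧
      ∀ u ∈ Set.Ioo a 1, 0 < FHDeriv θ u := by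
  obtain ⟨c, hc0, hc⟩ : ∃ c : ℝ, 0 < c ∧ c ^ 2 = 1 - θ :=
    ⟨√(1 - θ), Real.sqrt_pos.mpr (by linarith), Real.sq_sqrt (by linarith)⟩
  have hc1 : c < 1 := by nlinarith
  have hcont : ContinuousOn (FHDeriv θ) (Set.Ico 0 1) := fun u hu =>
    (hasDerivAt_FHDeriv θ ⟨by linarith [hu.1], hu.2⟩).continuousAt.continuousWithinAt
  have hanti : StrictAntiOn (FHDeriv θ) (Set.Icc 0 c) := by
    refine strictAntiOn_of_deriv_neg (convex_Icc 0 c)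
      (hcont.mono fun u hu => ⟨hu.1, by linarith [hu.2]⟩) fun u hu => ?_
    rw [interior_Icc] at hu
    obtain ⟨h0, h1⟩ := hu
    rw [(hasDerivAt_FHDeriv θ ⟨by linarith, by linarith⟩).deriv, sub_neg,
      div_lt_one (by nlinarith)]
    nlinarith
  have hmono : StrictMonoOn (FHDeriv θ) (Set.Ico c 1) := by
    refine strictMonoOn_of_deriv_pos (convex_Ico c 1)
      (hcont.mono fun u hu => ⟨by linarith [hu.1], hu.2⟩) fun u hu => ?_
    rw [interior_Ico] at hu
    obtain ⟨h0, h1⟩ := hu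
    rw [(hasDerivAt_FHDeriv θ ⟨by linarith, by linarith⟩).deriv, sub_pos,
      one_lt_div (by nlinarith)]
    nlinarith
  have hneg : ∀ u, 0 < u → u ≤ c → FHDeriv θ u < 0 := fun u h0 h1 => by
    simpa [FHDeriv_zero] using hanti ⟨le_rfl, hc0.le⟩ ⟨h0.le, h1⟩ h0
  obtain ⟨t, ⟨ht0, ht1⟩, ht⟩ := exists_FHDeriv_pos hθ0
  have hct : c < t := by
    by_contra! h
    exact (hneg t ht0 h).not_gt ht
  obtain ⟨a, ⟨hca, hat⟩, ha⟩ := intermediate_value_Ioo hct.le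
    (hcont.mono fun u hu => ⟨by linarith [hu.1], by linarith [hu.2]⟩)
    (show (0 : ℝ) ∈ Set.Ioo (FHDeriv θ c) (FHDeriv θ t) from ⟨hneg c hc0 le_rfl, ht⟩)
  have ha1 : a < 1 := hat.trans ht1
  refine ⟨a, ⟨hc0.trans hca, ha1⟩, ha, fun u hu => ?_, fun u hu => ?_⟩
  · rcases le_total u c with h | h
    · exact hneg u hu.1 h
    · exact ha ▸ hmono ⟨h, hu.2.trans ha1⟩ ⟨hca.le, ha1⟩ hu.2
  · exact ha ▸ hmono ⟨hca.le, ha1⟩ ⟨hca.le.trans hu.1.le, hu.2⟩ hu.1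

/-- If `0 < θ < 1`, then `W′(0) = 0` and `0` is a strict local maximum of `W`; there is a
unique `u_θ ∈ (0,1)` with `W′(u_θ) = 0` (where `W′(u) = (θ/2)ln((1+u)/(1−u)) − u`);
`W` is strictly decreasing on `[0, u_θ]` and strictly increasing on `[u_θ, 1]`;
consequently the minimum of `W` over `[−1, 1]` is attained exactly at `u_θ` and `−u_θ`,
and `W(u_θ) = W(−u_θ)`. -/
theorem stmt1 (θ : ℝ) (hθ0 : 0 < θ) (hθ1 : θ < 1) :
    HasDerivAt (FH θ) 0 0 ∧
    (∃ ε > 0, ∀ u : ℝ, u ≠ 0 → |u| < ε → FH θ u < FH θ 0) ∧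
    (∃ uθ : ℝ, uθ ∈ Set.Ioo (0 : ℝ) 1 ∧
      θ / 2 * Real.log ((1 + uθ) / (1 - uθ)) - uθ = 0 ∧
      (∀ v ∈ Set.Ioo (0 : ℝ) 1, θ / 2 * Real.log ((1 + v) / (1 - v)) - v = 0 → v = uθ) ∧
      StrictAntiOn (FH θ) (Set.Icc 0 uθ) ∧
      StrictMonoOn (FH θ) (Set.Icc uθ 1) ∧
      (∀ u ∈ Set.Icc (-1 : ℝ) 1, FH θ uθ ≤ FH θ u) ∧
      (∀ u ∈ Set.Icc (-1 : ℝ) 1, FH θ u = FH θ uθ → u = uθ ∨ u = -uθ) ∧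
      FH θ uθ = FH θ (-uθ)) := by
  obtain ⟨a, ⟨ha0, ha1⟩, ha, hneg, hpos⟩ := exists_FHDeriv_sign_change hθ0 hθ1
  have hanti : StrictAntiOn (FH θ) (Set.Icc 0 a) := by
    refine strictAntiOn_of_deriv_neg (convex_Icc 0 a) (continuous_FH θ).continuousOn fun u hu => ?_
    rw [interior_Icc] at hu
    rw [(hasDerivAt_FH θ ⟨by linarith [hu.1], by linarith [hu.2]⟩).deriv]
    exact hneg u hu
  have hmono : StrictMonoOn (FH θ) (Set.Icc a 1) := by
    refine strictMonoOn_of_deriv_pos (convex_Icc a 1) (continuous_FH θ).continuousOn fun u hu => ?_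
    rw [interior_Icc] at hu
    rw [(hasDerivAt_FH θ ⟨by linarith [hu.1], hu.2⟩).deriv]
    exact hpos u hu
  have hlt : ∀ u ∈ Set.Icc (-1 : ℝ) 1, |u| ≠ a → FH θ a < FH θ u := fun u hu hne => by
    rw [← FH_abs θ u]
    rcases hne.lt_or_gt with h | h
    · exact hanti ⟨abs_nonneg u, h.le⟩ ⟨ha0.le, le_rfl⟩ h
    · exact hmono ⟨le_rfl, ha1.le⟩ ⟨h.le, abs_le.mpr hu⟩ h
  refine ⟨?_, ⟨a, ha0, fun u hu0 hua => ?_⟩, a, ⟨ha0, ha1⟩, ha, fun v hv hv0 => ?_, hanti, hmono,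
    fun u hu => ?_, fun u hu heq => ?_, (FH_neg θ a).symm⟩
  · simpa only [FHDeriv_zero] using hasDerivAt_FH θ (u := 0) (by norm_num)
  · rw [← FH_abs θ u]
    exact hanti ⟨le_rfl, ha0.le⟩ ⟨abs_nonneg u, hua.le⟩ (abs_pos.mpr hu0)
  · rcases lt_trichotomy v a with h | h | h
    · exact absurd hv0 (hneg v ⟨hv.1, h⟩).ne
    · exact h
    · exact absurd hv0 (hpos v ⟨h, hv.2⟩).ne'
  · by_cases h : |u| = a
    · rw [← FH_abs θ u, h]
    · exact (hlt u hu h).le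
  · by_contra h
    exact (hlt u hu fun h' => h ((abs_eq ha0.le).mp h')).ne' heq
end

section
/- Under the stated assumptions, u(x) ≤ u_θ for all x ∈ Ω. -/
/-- The Laplacian of `u : ℝⁿ → ℝ` at `x`, defined as the sum of the second partial
derivatives in the coordinate directions. -/
noncomputable def lap (n : ℕ) (u : EuclideanSpace ℝ (Fin n) → ℝ)
    (x : EuclideanSpace ℝ (Fin n)) : ℝ :=
  ∑ i : Fin n,
    fderiv ℝ (fun y => fderiv ℝ u y (EuclideanSpace.single i 1)) x (EuclideanSpace.single i 1)

/-- If `g` has a local maximum at `a` and is continuous there, its second derivative at `a` is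
nonpositive. -/
theorem deriv_deriv_nonpos_of_isLocalMax {g : ℝ → ℝ} {a : ℝ} (hmax : IsLocalMax g a)
    (hg : ContinuousAt g a) : deriv (deriv g) a ≤ 0 := by
  by_contra! hpos
  have hmin : IsLocalMin g a := isLocalMin_of_deriv_deriv_pos hpos hmax.deriv_eq_zero hg
  have hconst : g =ᶠ[nhds a] fun _ => g a := by
    filter_upwards [hmax, hmin] with t h₁ h₂ using le_antisymm h₁ h₂
  have hzero : deriv (deriv g) a = 0 := by
    rw [hconst.deriv.deriv_eq]
    simp
  exact hpos.ne' hzero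

/-- At a local maximum of a `C²` function, every pure second directional derivative is
nonpositive. -/
theorem fderiv_fderiv_apply_nonpos_of_isLocalMax {E : Type*} [NormedAddCommGroup E]
    [NormedSpace ℝ E] {u : E → ℝ} {x : E} (hu : ContDiffAt ℝ 2 u x) (hmax : IsLocalMax u x)
    (e : E) : fderiv ℝ (fun y => fderiv ℝ u y e) x e ≤ 0 := by
  have hline : ∀ t : ℝ, HasDerivAt (fun s : ℝ => x + s • e) e t := fun t => by
    simpa using ((hasDerivAt_id t).smul_const e).const_add x
  have hx : x + (0 : ℝ) • e = x := by simp
  have htend : Filter.Tendsto (fun s : ℝ => x + s • e) (nhds 0) (nhds x) := by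
    have h := (hline 0).continuousAt.tendsto
    rwa [hx] at h
  have hdiff : ∀ᶠ y in nhds x, DifferentiableAt ℝ u y :=
    (hu.eventually (by simp)).mono fun y hy => hy.differentiableAt (by simp)
  have hderiv : deriv (fun s : ℝ => u (x + s • e)) =ᶠ[nhds 0]
      fun s => fderiv ℝ u (x + s • e) e := by
    filter_upwards [htend.eventually hdiff] with t ht
    exact (ht.hasFDerivAt.comp_hasDerivAt t (hline t)).deriv
  have hfderiv : DifferentiableAt ℝ (fun y => fderiv ℝ u y e) x :=
    ((hu.fderiv_right (m := 1) (by norm_num)).differentiableAt (by simp)).clm_apply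
      (differentiableAt_const e)
  have hsecond : deriv (deriv fun s : ℝ => u (x + s • e)) 0
      = fderiv ℝ (fun y => fderiv ℝ u y e) x e := by
    rw [hderiv.deriv_eq]
    exact (hfderiv.hasFDerivAt.comp_hasDerivAt_of_eq 0 (hline 0) hx.symm).deriv
  rw [← hsecond]
  refine deriv_deriv_nonpos_of_isLocalMax ?_ ?_
  · have h := htend.eventually hmax
    simpa [IsLocalMax, IsMaxFilter] using h
  · exact ContinuousAt.comp_of_eq hu.continuousAt (hline 0).continuousAt hx

/-- The Laplacian of a `C²` function is nonpositive at a local maximum. -/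
theorem lap_nonpos_of_isLocalMax {n : ℕ} {u : EuclideanSpace ℝ (Fin n) → ℝ}
    {x : EuclideanSpace ℝ (Fin n)} (hu : ContDiffAt ℝ 2 u x) (hmax : IsLocalMax u x) :
    lap n u x ≤ 0 :=
  Finset.sum_nonpos fun _ _ => fderiv_fderiv_apply_nonpos_of_isLocalMax hu hmax _

/-- If the derivative of the Flory–Huggins potential is nonpositive at `v ∈ (0, 1)`, then it
has a zero in `[v, 1)`. -/
theorem exists_floryHuggins_deriv_eq_zero {θ v : ℝ} (hθ : 0 < θ) (hv : v ∈ Set.Ioo (0 : ℝ) 1)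
    (hneg : θ / 2 * Real.log ((1 + v) / (1 - v)) - v ≤ 0) :
    ∃ w ∈ Set.Ico v 1, θ / 2 * Real.log ((1 + w) / (1 - w)) - w = 0 := by
  obtain ⟨hv0, hv1⟩ := hv
  set s := min (1 - v) (Real.exp (-(2 / θ))) with hs
  have hs0 : 0 < s := lt_min (by linarith) (Real.exp_pos _)
  have hsv : s ≤ 1 - v := min_le_left _ _
  have hlog : 2 / θ ≤ Real.log ((1 + (1 - s)) / (1 - (1 - s))) := by
    rw [Real.le_log_iff_exp_le (div_pos (by linarith) (by linarith)),
      le_div_iff₀ (by linarith)]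
    calc Real.exp (2 / θ) * (1 - (1 - s)) ≤ Real.exp (2 / θ) * Real.exp (-(2 / θ)) := by
          gcongr
          linarith [min_le_right (1 - v) (Real.exp (-(2 / θ)))]
      _ = 1 := by rw [← Real.exp_add]; simp
      _ ≤ 1 + (1 - s) := by linarith
  have hpos : 0 ≤ θ / 2 * Real.log ((1 + (1 - s)) / (1 - (1 - s))) - (1 - s) := by
    have h : θ / 2 * (2 / θ) ≤ θ / 2 * Real.log ((1 + (1 - s)) / (1 - (1 - s))) := by gcongr
    have h' : θ / 2 * (2 / θ) = 1 := by field_simp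
    linarith
  have hcont : ContinuousOn (fun w : ℝ => θ / 2 * Real.log ((1 + w) / (1 - w)) - w)
      (Set.Icc v (1 - s)) := by
    refine (continuousOn_const.mul (ContinuousOn.log (ContinuousOn.div (by fun_prop)
      (by fun_prop) ?_) ?_)).sub continuousOn_id
    · rintro w ⟨_, hw⟩
      linarith
    · rintro w ⟨hw, hw'⟩
      exact (div_pos (by linarith) (by linarith)).ne'
  obtain ⟨w, hw, hw0⟩ := intermediate_value_Icc (by linarith) hcont ⟨hneg, hpos⟩
  exact ⟨w, ⟨hw.1, by linarith [hw.2]⟩, hw0⟩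

/-- Let `Ω ⊆ ℝⁿ` be a bounded open set, `κ > 0`, `0 < θ < 1`, and let `u_θ` be the unique
zero in `(0,1)` of `W′(u) = (θ/2)ln((1+u)/(1−u)) − u`. If `u` is continuous on the closure
of `Ω`, `C²` on `Ω`, vanishes on `∂Ω`, satisfies `0 ≤ u < 1` on `Ω`, and solves
`κ·Δu = (θ/2)ln((1+u)/(1−u)) − u` on `Ω`, then `u(x) ≤ u_θ` for all `x ∈ Ω`. -/
theorem stmt14 (n : ℕ) (Ω : Set (EuclideanSpace ℝ (Fin n)))
    (hΩo : IsOpen Ω) (hΩb : Bornology.IsBounded Ω)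
    (κ θ : ℝ) (hκ : 0 < κ) (hθ0 : 0 < θ) (hθ1 : θ < 1)
    (uθ : ℝ) (huθ : uθ ∈ Set.Ioo (0 : ℝ) 1)
    (hroot : θ / 2 * Real.log ((1 + uθ) / (1 - uθ)) - uθ = 0)
    (huniq : ∀ v ∈ Set.Ioo (0 : ℝ) 1,
      θ / 2 * Real.log ((1 + v) / (1 - v)) - v = 0 → v = uθ)
    (u : EuclideanSpace ℝ (Fin n) → ℝ)
    (hu_cont : ContinuousOn u (closure Ω))
    (hu_smooth : ContDiffOn ℝ 2 u Ω)
    (hu_bdry : ∀ x ∈ frontier Ω, u x = 0)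
    (hu_range : ∀ x ∈ Ω, 0 ≤ u x ∧ u x < 1)
    (hPDE : ∀ x ∈ Ω,
      κ * lap n u x = θ / 2 * Real.log ((1 + u x) / (1 - u x)) - u x) :
    ∀ x ∈ Ω, u x ≤ uθ := by
  intro x hx
  have hcompact : IsCompact (closure Ω) := hΩb.isCompact_closure
  obtain ⟨z, hz, hzmax⟩ := hcompact.exists_isMaxOn ⟨x, subset_closure hx⟩ hu_cont
  refine (hzmax (subset_closure hx)).trans ?_
  by_cases hzΩ : z ∈ Ω
  · by_contra! hlt
    have hnhds : Ω ∈ nhds z := hΩo.mem_nhds hzΩ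
    have hlap : lap n u z ≤ 0 :=
      lap_nonpos_of_isLocalMax (hu_smooth.contDiffAt hnhds)
        ((hzmax.on_subset subset_closure).isLocalMax hnhds)
    have hneg : θ / 2 * Real.log ((1 + u z) / (1 - u z)) - u z ≤ 0 := by
      rw [← hPDE z hzΩ]
      exact mul_nonpos_of_nonneg_of_nonpos hκ.le hlap
    obtain ⟨w, hw, hw0⟩ := exists_floryHuggins_deriv_eq_zero hθ0
      ⟨huθ.1.trans hlt, (hu_range z hzΩ).2⟩ hneg
    have hwθ := huniq w ⟨(huθ.1.trans hlt).trans_le hw.1, hw.2⟩ hw0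
    linarith [hw.1]
  · rw [hu_bdry z ⟨hz, by rwa [hΩo.interior_eq]⟩]
    exact huθ.1.le
end

section
/- If in addition Ω is connected and u is not identically zero on Ω, then u(x) > 0 for all x ∈ Ω. -/
open Filter Topology

/-- A twice differentiable function has nonnegative second derivative at a local minimum. -/
theorem IsLocalMin.deriv_deriv_nonneg {f : ℝ → ℝ} {a : ℝ} (h : IsLocalMin f a)
    (hc : ContinuousAt f a) : 0 ≤ deriv (deriv f) a := by
  by_contra! hneg
  have hmax : IsLocalMax f a :=
    isLocalMax_of_deriv_deriv_neg hneg h.deriv_eq_zero hc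
  have hconst : f =ᶠ[𝓝 a] fun _ => f a := by
    filter_upwards [h, hmax] with x h₁ h₂ using le_antisymm h₂ h₁
  have h0 : deriv (deriv f) a = 0 := by
    rw [hconst.deriv.deriv_eq]
    simp
  exact hneg.ne h0

section Line

variable {E : Type*} [NormedAddCommGroup E] [NormedSpace ℝ E]

theorem ContDiffAt.differentiableAt_fderiv_apply {f : E → ℝ} {p : E} (hf : ContDiffAt ℝ 2 f p)
    (e : E) : DifferentiableAt ℝ (fun y => fderiv ℝ f y e) p := by
  have h : ContDiffAt ℝ 1 (fderiv ℝ f) p := hf.fderiv_right (by norm_num)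
  exact (h.differentiableAt (by norm_num)).clm_apply (differentiableAt_const e)

theorem hasDerivAt_line (p e : E) (t : ℝ) : HasDerivAt (fun s : ℝ => p + s • e) e t := by
  simpa using ((hasDerivAt_id t).smul_const e).const_add p

theorem ContDiffAt.eventually_deriv_line {f : E → ℝ} {p : E} (hf : ContDiffAt ℝ 2 f p) (e : E) :
    ∀ᶠ t : ℝ in 𝓝 0, HasDerivAt (fun s : ℝ => f (p + s • e)) (fderiv ℝ f (p + t • e) e) t := by
  have hline : Tendsto (fun s : ℝ => p + s • e) (𝓝 0) (𝓝 p) := by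
    simpa using (hasDerivAt_line p e 0).continuousAt.tendsto
  filter_upwards [hline.eventually (hf.eventually (by simp))] with t ht
  exact (ht.differentiableAt (by norm_num)).hasFDerivAt.comp_hasDerivAt t (hasDerivAt_line p e t)

/-- Comparison of pure second derivatives at a local minimum of a difference. -/
theorem IsLocalMin.fderiv_fderiv_le {f g : E → ℝ} {p : E} (hf : ContDiffAt ℝ 2 f p)
    (hg : ContDiffAt ℝ 2 g p) (h : IsLocalMin (fun x => f x - g x) p) (e : E) :
    fderiv ℝ (fun y => fderiv ℝ g y e) p e ≤ fderiv ℝ (fun y => fderiv ℝ f y e) p e := by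
  have hline : Tendsto (fun s : ℝ => p + s • e) (𝓝 0) (𝓝 p) := by
    simpa using (hasDerivAt_line p e 0).continuousAt.tendsto
  have hmin : IsLocalMin (fun t : ℝ => f (p + t • e) - g (p + t • e)) 0 := by
    have := hline.eventually h
    simpa [IsLocalMin, IsMinFilter] using this
  have hd : deriv (fun t : ℝ => f (p + t • e) - g (p + t • e)) =ᶠ[𝓝 0]
      fun t => fderiv ℝ f (p + t • e) e - fderiv ℝ g (p + t • e) e := by
    filter_upwards [hf.eventually_deriv_line e, hg.eventually_deriv_line e] with t h₁ h₂
    exact (h₁.sub h₂).deriv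
  have hsecond : ∀ {k : E → ℝ}, ContDiffAt ℝ 2 k p →
      HasDerivAt (fun t : ℝ => fderiv ℝ k (p + t • e) e)
        (fderiv ℝ (fun y => fderiv ℝ k y e) p e) 0 := by
    intro k hk
    have h₁ : HasFDerivAt (fun y => fderiv ℝ k y e) (fderiv ℝ (fun y => fderiv ℝ k y e) p)
        (p + (0 : ℝ) • e) := by
      simpa using (hk.differentiableAt_fderiv_apply e).hasFDerivAt
    exact h₁.comp_hasDerivAt 0 (hasDerivAt_line p e 0)
  have h0 := hmin.deriv_deriv_nonneg
    ((hf.eventually_deriv_line e).self_of_nhds.sub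
      (hg.eventually_deriv_line e).self_of_nhds).continuousAt
  rw [hd.deriv_eq, ((hsecond hf).fun_sub (hsecond hg)).deriv] at h0
  linarith

end Line

theorem IsLocalMin.lap_le {n : ℕ} {f g : EuclideanSpace ℝ (Fin n) → ℝ}
    {p : EuclideanSpace ℝ (Fin n)} (hf : ContDiffAt ℝ 2 f p) (hg : ContDiffAt ℝ 2 g p)
    (h : IsLocalMin (fun x => f x - g x) p) : lap n g p ≤ lap n f p :=
  Finset.sum_le_sum fun _ _ => h.fderiv_fderiv_le hf hg _

section Barrier

variable {n : ℕ} (c : EuclideanSpace ℝ (Fin n)) (a b ε : ℝ)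

/-- The Gaussian barrier used in the proof of the strong minimum principle. -/
noncomputable def gaussianBarrier (x : EuclideanSpace ℝ (Fin n)) : ℝ :=
  ε * (Real.exp (-a * ‖x - c‖ ^ 2) - b)

theorem contDiff_gaussianBarrier : ContDiff ℝ 2 (gaussianBarrier c a b ε) := by
  have : ContDiff ℝ 2 fun x : EuclideanSpace ℝ (Fin n) => ‖x - c‖ ^ 2 :=
    (contDiff_id.sub contDiff_const).norm_sq ℝ
  unfold gaussianBarrier
  fun_prop

theorem hasFDerivAt_gaussian (x : EuclideanSpace ℝ (Fin n)) :
    HasFDerivAt (fun x => Real.exp (-a * ‖x - c‖ ^ 2))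
      (Real.exp (-a * ‖x - c‖ ^ 2) • (-a) • (2 : ℝ) • innerSL ℝ (x - c)) x := by
  have h₁ : HasFDerivAt (fun x : EuclideanSpace ℝ (Fin n) => ‖x - c‖ ^ 2)
      ((2 : ℝ) • innerSL ℝ (x - c)) x := by
    have := ((hasFDerivAt_id x).sub_const c).norm_sq
    refine this.congr_fderiv ?_
    ext v
    simp
  exact (h₁.const_mul (-a)).exp

theorem fderiv_gaussianBarrier_apply (x e : EuclideanSpace ℝ (Fin n)) :
    fderiv ℝ (gaussianBarrier c a b ε) x e =
      ε * (-2 * a) * (Real.exp (-a * ‖x - c‖ ^ 2) * inner ℝ (x - c) e) := by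
  have : HasFDerivAt (gaussianBarrier c a b ε) _ x :=
    ((hasFDerivAt_gaussian c a x).sub_const b).const_mul ε
  rw [this.fderiv]
  simp only [FunLike.coe_smul, Pi.smul_apply, innerSL_apply_apply, smul_eq_mul]
  ring

theorem lap_gaussianBarrier (x : EuclideanSpace ℝ (Fin n)) :
    lap n (gaussianBarrier c a b ε) x =
      ε * (2 * a) * Real.exp (-a * ‖x - c‖ ^ 2) * (2 * a * ‖x - c‖ ^ 2 - n) := by
  have hterm : ∀ i : Fin n,
      fderiv ℝ (fun y => fderiv ℝ (gaussianBarrier c a b ε) y (EuclideanSpace.single i 1)) x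
        (EuclideanSpace.single i 1) =
      ε * (2 * a) * Real.exp (-a * ‖x - c‖ ^ 2) * (2 * a * ((x - c) i) ^ 2 - 1) := by
    intro i
    simp_rw [fderiv_gaussianBarrier_apply]
    have h₁ : HasFDerivAt (fun y : EuclideanSpace ℝ (Fin n) =>
        inner ℝ (y - c) (EuclideanSpace.single i (1 : ℝ)))
        (innerSL ℝ (EuclideanSpace.single i (1 : ℝ))) x := by
      have := (innerSL ℝ (EuclideanSpace.single i (1 : ℝ))).hasFDerivAt.comp x
        ((hasFDerivAt_id x).sub_const c)
      simpa [Function.comp_def, real_inner_comm] using this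
    rw [(((hasFDerivAt_gaussian c a x).fun_mul h₁).const_mul (ε * (-2 * a))).fderiv]
    simp [EuclideanSpace.inner_single_right]
    ring
  rw [lap, Finset.sum_congr rfl fun i _ => hterm i, ← Finset.mul_sum, Finset.sum_sub_distrib,
    ← Finset.mul_sum, EuclideanSpace.real_norm_sq_eq]
  simp

end Barrier

/-- Local strong minimum principle: a nonnegative superharmonic function that vanishes at the
centre of a ball vanishes nearby. -/
theorem eq_zero_of_lap_nonpos {n : ℕ} {u : EuclideanSpace ℝ (Fin n) → ℝ}
    {x₀ : EuclideanSpace ℝ (Fin n)} {r : ℝ} (hu : ContDiffOn ℝ 2 u (Metric.ball x₀ r))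
    (hlap : ∀ x ∈ Metric.ball x₀ r, lap n u x ≤ 0) (hnonneg : ∀ x ∈ Metric.ball x₀ r, 0 ≤ u x)
    (h0 : u x₀ = 0) : ∀ y ∈ Metric.ball x₀ (r / 4), u y = 0 := by
  intro y hy
  by_contra hy0
  rw [Metric.mem_ball] at hy
  set d := dist y x₀ with hd
  have hcl : Metric.closedBall y d ⊆ Metric.ball x₀ r := by
    intro x hx
    rw [Metric.mem_closedBall] at hx
    rw [Metric.mem_ball]
    linarith [dist_triangle x y x₀, dist_nonneg (x := y) (y := x₀)]
  have hcont : ContinuousOn u (Metric.closedBall y d) := hu.continuousOn.mono hcl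
  have hK : IsCompact (Metric.closedBall y d ∩ u ⁻¹' {0}) :=
    (isCompact_closedBall y d).of_isClosed_subset
      (hcont.preimage_isClosed_of_isClosed Metric.isClosed_closedBall isClosed_singleton)
      Set.inter_subset_left
  obtain ⟨z, ⟨hzball, hz0⟩, hzmin⟩ := hK.exists_isMinOn (f := fun x => dist x y)
    ⟨x₀, by simp [hd, dist_comm], h0⟩ (by fun_prop)
  replace hz0 : u z = 0 := hz0
  rw [Metric.mem_closedBall] at hzball
  obtain ⟨ρ, hρ⟩ : ∃ ρ, dist z y = 2 * ρ := ⟨dist z y / 2, by ring⟩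
  have hρ0 : 0 < ρ := by
    have : 0 < dist z y := dist_pos.2 fun h => hy0 (h ▸ hz0)
    linarith
  set c := midpoint ℝ y z with hc
  have hapollonius : ∀ x, dist x y ^ 2 + dist x z ^ 2 = 2 * dist x c ^ 2 + 2 * ρ ^ 2 := by
    intro x
    have h₁ := parallelogram_law_with_norm ℝ (x - y) (x - z)
    have h₂ : (x - y) + (x - z) = (2 : ℝ) • (x - c) := by
      rw [hc, midpoint_eq_smul_add, smul_sub, smul_smul]
      norm_num [two_smul]
      abel
    have h₃ : (x - y) - (x - z) = z - y := by abel
    rw [h₂, h₃, norm_smul, ← dist_eq_norm, ← dist_eq_norm, ← dist_eq_norm, ← dist_eq_norm, hρ] at h₁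
    norm_num at h₁
    nlinarith
  have hzc : dist z c = ρ := by
    have := hapollonius z
    rw [dist_self, hρ] at this
    exact (sq_eq_sq₀ dist_nonneg hρ0.le).1 (by nlinarith)
  have hpos : ∀ x ∈ Metric.closedBall c ρ, x ≠ z → 0 < u x := by
    intro x hx hxz
    rw [Metric.mem_closedBall] at hx
    have hxy : dist x y < dist z y := by
      have h₁ := hapollonius x
      have h₂ : 0 < dist x z := dist_pos.2 hxz
      have h₃ : dist x c ^ 2 ≤ ρ ^ 2 := pow_le_pow_left₀ dist_nonneg hx 2
      rw [hρ]
      exact lt_of_pow_lt_pow_left₀ 2 (by linarith) (by nlinarith)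
    have hxK : x ∈ Metric.closedBall y d := Metric.mem_closedBall.2 (hxy.le.trans hzball)
    refine lt_of_le_of_ne (hnonneg x (hcl hxK)) fun h => ?_
    exact absurd (hzmin (show x ∈ _ ∩ _ from ⟨hxK, h.symm⟩)) (not_le.2 hxy)
  have hB : Metric.closedBall z (ρ / 2) ⊆ Metric.ball x₀ r := by
    intro x hx
    rw [Metric.mem_closedBall] at hx
    rw [Metric.mem_ball]
    linarith [dist_triangle x z x₀, dist_triangle z y x₀]
  have hC : IsCompact (Metric.sphere z (ρ / 2) ∩ Metric.closedBall c ρ) :=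
    (isCompact_sphere z (ρ / 2)).inter_right Metric.isClosed_closedBall
  obtain ⟨m, hm0, hm⟩ : ∃ m, 0 < m ∧
      ∀ x ∈ Metric.sphere z (ρ / 2) ∩ Metric.closedBall c ρ, m ≤ u x := by
    refine hC.exists_forall_le'
      (hu.continuousOn.mono fun x hx => hB (Metric.sphere_subset_closedBall hx.1)) ?_
    rintro x ⟨hxs, hxc⟩
    refine hpos x hxc (Metric.ne_of_mem_sphere hxs (by positivity))
  obtain ⟨a, ha0, ha⟩ : ∃ a : ℝ, 0 < a ∧ (n : ℝ) < 2 * a * (ρ / 2) ^ 2 := by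
    refine ⟨(n + 1) / (2 * (ρ / 2) ^ 2), by positivity, ?_⟩
    field_simp
    linarith
  set w := gaussianBarrier c a (Real.exp (-a * ρ ^ 2)) m with hw
  have hwC : ContDiff ℝ 2 w := contDiff_gaussianBarrier ..
  obtain ⟨p, hpB, hpmin⟩ := (isCompact_closedBall z (ρ / 2)).exists_isMinOn
    (f := fun x => u x - w x) ⟨z, Metric.mem_closedBall_self (by positivity)⟩
    ((hu.continuousOn.mono hB).sub hwC.continuous.continuousOn)
  have hwz : w z = 0 := by simp [hw, gaussianBarrier, ← dist_eq_norm, hzc]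
  have hple : u p - w p ≤ 0 := by
    have := hpmin (Metric.mem_closedBall_self (by positivity) : z ∈ Metric.closedBall z (ρ / 2))
    simpa [hz0, hwz] using this
  have hpint : p ∈ Metric.ball z (ρ / 2) := by
    by_contra hp
    have hps : p ∈ Metric.sphere z (ρ / 2) :=
      le_antisymm (Metric.mem_closedBall.1 hpB) (not_lt.1 hp)
    rcases le_or_gt (dist p c) ρ with h | h
    · have h₁ := hm p ⟨hps, h⟩
      have h₂ : w p < m := by
        have h₃ : Real.exp (-a * ‖p - c‖ ^ 2) ≤ 1 :=
          Real.exp_le_one_iff.2 (by nlinarith [sq_nonneg ‖p - c‖])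
        have h₄ := Real.exp_pos (-a * ρ ^ 2)
        simp only [hw, gaussianBarrier]
        nlinarith
      linarith
    · have h₁ : w p < 0 := by
        have h₂ : Real.exp (-a * ‖p - c‖ ^ 2) < Real.exp (-a * ρ ^ 2) := by
          rw [Real.exp_lt_exp, ← dist_eq_norm]
          have : ρ ^ 2 < dist p c ^ 2 := pow_lt_pow_left₀ h hρ0.le (by norm_num)
          nlinarith
        exact mul_neg_of_pos_of_neg hm0 (by linarith)
      linarith [hnonneg p (hB hpB)]
  have hlocal : IsLocalMin (fun x => u x - w x) p :=
    hpmin.isLocalMin (Filter.mem_of_superset (Metric.isOpen_ball.mem_nhds hpint)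
      Metric.ball_subset_closedBall)
  have hpc : ρ / 2 ≤ dist p c := by
    have := dist_triangle z p c
    rw [dist_comm z p] at this
    linarith [Metric.mem_ball.1 hpint]
  have hle := hlocal.lap_le (hu.contDiffAt (Metric.isOpen_ball.mem_nhds (hB hpB))) hwC.contDiffAt
  have hwpos : 0 < lap n w p := by
    rw [hw, lap_gaussianBarrier, ← dist_eq_norm]
    have h₁ : (ρ / 2) ^ 2 ≤ dist p c ^ 2 := pow_le_pow_left₀ (by positivity) hpc 2
    have h₂ : 0 < 2 * a * dist p c ^ 2 - n := by nlinarith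
    positivity
  linarith [hlap p (hB hpB)]

theorem log_div_le {v : ℝ} (hv0 : 0 ≤ v) (hv1 : v < 1) :
    Real.log ((1 + v) / (1 - v)) ≤ 2 * v / (1 - v) := by
  have h : 0 < 1 - v := by linarith
  refine (Real.log_le_sub_one_of_pos (by positivity)).trans_eq ?_
  field_simp
  ring

/-- Let `Ω ⊆ ℝⁿ` be a bounded open set, `κ > 0`, `0 < θ < 1`, and let `u_θ` be the unique
zero in `(0,1)` of `W′(u) = (θ/2)ln((1+u)/(1−u)) − u`. If `u` is continuous on the closure
of `Ω`, `C²` on `Ω`, vanishes on `∂Ω`, satisfies `0 ≤ u < 1` on `Ω`, and solves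
`κ·Δu = (θ/2)ln((1+u)/(1−u)) − u` on `Ω`, and if moreover `Ω` is connected and `u` is not identically zero on `Ω`,
then `u(x) > 0` for all `x ∈ Ω`. -/
theorem stmt15 (n : ℕ) (Ω : Set (EuclideanSpace ℝ (Fin n)))
    (hΩo : IsOpen Ω) (hΩb : Bornology.IsBounded Ω)
    (κ θ : ℝ) (hκ : 0 < κ) (hθ0 : 0 < θ) (hθ1 : θ < 1)
    (uθ : ℝ) (huθ : uθ ∈ Set.Ioo (0 : ℝ) 1)
    (hroot : θ / 2 * Real.log ((1 + uθ) / (1 - uθ)) - uθ = 0)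
    (huniq : ∀ v ∈ Set.Ioo (0 : ℝ) 1,
      θ / 2 * Real.log ((1 + v) / (1 - v)) - v = 0 → v = uθ)
    (u : EuclideanSpace ℝ (Fin n) → ℝ)
    (hu_cont : ContinuousOn u (closure Ω))
    (hu_smooth : ContDiffOn ℝ 2 u Ω)
    (hu_bdry : ∀ x ∈ frontier Ω, u x = 0)
    (hu_range : ∀ x ∈ Ω, 0 ≤ u x ∧ u x < 1)
    (hΩc : IsConnected Ω)
    (hne : ∃ x ∈ Ω, u x ≠ 0)
    (hPDE : ∀ x ∈ Ω,
      κ * lap n u x = θ / 2 * Real.log ((1 + u x) / (1 - u x)) - u x) :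
    ∀ x ∈ Ω, 0 < u x := by
  have hzero : ∀ x₀ ∈ Ω, u x₀ = 0 → ∀ᶠ y in 𝓝 x₀, y ∈ Ω ∧ u y = 0 := by
    intro x₀ hx₀ h0
    have hcont : ContinuousAt u x₀ := hu_smooth.continuousOn.continuousAt (hΩo.mem_nhds hx₀)
    have hsmall : ∀ᶠ y in 𝓝 x₀, u y < 1 - θ :=
      hcont.eventually (gt_mem_nhds (by rw [h0]; linarith))
    obtain ⟨r, hr, hball⟩ := Metric.eventually_nhds_iff_ball.1
      ((hΩo.eventually_mem hx₀).and hsmall)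
    have hlap : ∀ x ∈ Metric.ball x₀ r, lap n u x ≤ 0 := by
      intro x hx
      obtain ⟨hxΩ, hxs⟩ := hball x hx
      obtain ⟨hx0, hx1⟩ := hu_range x hxΩ
      have h₁ : θ / 2 * Real.log ((1 + u x) / (1 - u x)) ≤ u x := by
        refine (mul_le_mul_of_nonneg_left (log_div_le hx0 hx1) (by positivity)).trans ?_
        have h : 0 < 1 - u x := by linarith
        rw [mul_div_assoc', div_le_iff₀ h]
        nlinarith
      by_contra! hneg
      linarith [hPDE x hxΩ, mul_pos hκ hneg]
    have hlocal := eq_zero_of_lap_nonpos (hu_smooth.mono fun x hx => (hball x hx).1) hlap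
      (fun x hx => (hu_range x (hball x hx).1).1) h0
    filter_upwards [hΩo.mem_nhds hx₀, Metric.ball_mem_nhds x₀ (by positivity : 0 < r / 4)]
      with y hyΩ hy using ⟨hyΩ, hlocal y hy⟩
  intro x hx
  refine lt_of_le_of_ne (hu_range x hx).1 fun hx0 => ?_
  obtain ⟨x₁, hx₁, hx₁0⟩ := hne
  have hopen : IsOpen {y | y ∈ Ω ∧ u y = 0} :=
    isOpen_iff_mem_nhds.2 fun y hy => hzero y hy.1 hy.2
  have hopen' : IsOpen (Ω ∩ u ⁻¹' {0}ᶜ) :=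
    hu_smooth.continuousOn.isOpen_inter_preimage hΩo isOpen_compl_singleton
  obtain ⟨y, -, hy, hy'⟩ := hΩc.isPreconnected _ _ hopen hopen'
    (fun y hy => (eq_or_ne (u y) 0).imp (fun h => ⟨hy, h⟩) fun h => ⟨hy, h⟩)
    ⟨x, hx, hx, hx0.symm⟩ ⟨x₁, hx₁, hx₁, hx₁0⟩
  exact hy'.2 hy.2
end
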